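/- Let G be a 2K2-free finite simple graph, let ab be an edge of G, and let X be a minimal dominating set of G with a, b ∈ X and |X| > α(G). With N, A, Y, Z defined as in the context, if |Y| > 1 then every private neighbour of a with respect to X and every private neighbour of b with respect to X has no neighbour in Z. -/

import Mathlib

/-- A set `D` of vertices is dominating if every vertex not in `D` has a neighbour in `D`. -/
def Dominating {V : Type*} (G : SimpleGraph V) (D : Set V) : Prop :=
  ∀ v ∉ D, ∃ u ∈ D, G.Adj u v

/-- `D` is a minimal dominating set if it is dominating and no proper subset is dominating. -/
def MinimalDominating {V : Type*} (G : SimpleGraph V) (D : Set V) : Prop :=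
  Dominating G D ∧ ∀ D' ⊂ D, ¬ Dominating G D'

/-- An independent set is a set of pairwise non-adjacent vertices. -/
def IndepSet {V : Type*} (G : SimpleGraph V) (S : Set V) : Prop :=
  ∀ u ∈ S, ∀ v ∈ S, ¬ G.Adj u v

/-- `α(G)`: the maximum cardinality of an independent set of `G`. -/
noncomputable def indepNum {V : Type*} (G : SimpleGraph V) : ℕ :=
  sSup {n | ∃ S : Set V, IndepSet G S ∧ S.ncard = n}

/-- For `x ∈ D`, a vertex `y ∉ D` is a private neighbour of `x` (w.r.t. `D`) if `x` is the
only neighbour of `y` in `D`. -/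
def PrivateNbr {V : Type*} (G : SimpleGraph V) (D : Set V) (x y : V) : Prop :=
  x ∈ D ∧ y ∉ D ∧ G.Adj x y ∧ ∀ z ∈ D, G.Adj z y → z = x

/-- `G` is `2K₂`-free: it contains no induced subgraph isomorphic to the disjoint union of
two edges, i.e. any two edges on four distinct vertices are joined by some cross edge. -/
def TwoK2Free {V : Type*} (G : SimpleGraph V) : Prop :=
  ∀ a b c d : V, G.Adj a b → G.Adj c d → a ≠ c → a ≠ d → b ≠ c → b ≠ d →
    G.Adj a c ∨ G.Adj a d ∨ G.Adj b c ∨ G.Adj b d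

theorem exists_priv {V : Type*} (G : SimpleGraph V) (X : Set V) (hX : MinimalDominating G X)
    (x : V) (hx : x ∈ X) :
    ∃ v, (v = x ∧ ∀ u ∈ X, ¬ G.Adj u x) ∨ PrivateNbr G X x v := by
  by_cases hi : ∀ u ∈ X, ¬ G.Adj u x
  · exact ⟨x, Or.inl ⟨rfl, hi⟩⟩
  push Not at hi
  obtain ⟨u, hu, hux⟩ := hi
  have hss : X \ {x} ⊂ X := ⟨Set.diff_subset, fun h => (h hx).2 rfl⟩
  have hnd := hX.2 _ hss
  unfold Dominating at hnd
  push Not at hnd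
  obtain ⟨v, hv, hvn⟩ := hnd
  have hvx : v ≠ x := by
    rintro rfl
    exact hvn u ⟨hu, hux.ne⟩ hux
  have hvX : v ∉ X := fun h => hv ⟨h, hvx⟩
  have huniq : ∀ z ∈ X, G.Adj z v → z = x := fun z hz hzv => by
    by_contra hne
    exact hvn z ⟨hz, hne⟩ hzv
  obtain ⟨w, hw, hwv⟩ := hX.1 v hvX
  have := huniq w hw hwv
  subst this
  exact ⟨v, Or.inr ⟨hx, hvX, hwv, huniq⟩⟩

/-- Edge from `q` (private to `x`) to `r`, against edge `u w` with `u, w` not touching them. -/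
theorem far {V : Type*} {G : SimpleGraph V} (h2 : TwoK2Free G) {p z u w : V}
    (h : G.Adj p z) (h' : G.Adj u w) (h1 : ¬ G.Adj u p) (h3 : ¬ G.Adj w p)
    (h4 : ¬ G.Adj u z) (h5 : ¬ G.Adj w z) : False := by
  have e1 : p ≠ u := by rintro rfl; exact h4 h
  have e2 : p ≠ w := by rintro rfl; exact h5 h
  have e3 : z ≠ u := by rintro rfl; exact h1 h.symm
  have e4 : z ≠ w := by rintro rfl; exact h3 h.symm
  rcases h2 p z u w h h' e1 e2 e3 e4 with k | k | k | k
  · exact h1 k.symm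
  · exact h3 k.symm
  · exact h4 k.symm
  · exact h5 k.symm

theorem nonAdj_of {V : Type*} {G : SimpleGraph V} {X : Set V} {x q u : V}
    (h : PrivateNbr G X x q) (hu : u ∈ X) (hne : u ≠ x) : ¬ G.Adj u q :=
  fun k => hne (h.2.2.2 u hu k)

theorem priv_core {V : Type*} {G : SimpleGraph V} (h2 : TwoK2Free G) {X : Set V}
    {a b y1 y2 p p' q1 q2 : V} (hab : G.Adj a b)
    (hp : PrivateNbr G X a p) (hp' : PrivateNbr G X b p')
    (hq1 : PrivateNbr G X y1 q1) (hq2 : PrivateNbr G X y2 q2)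
    (h1a : y1 ≠ a) (h1b : y1 ≠ b) (h2a : y2 ≠ a) (h2b : y2 ≠ b) (h12 : y1 ≠ y2) :
    ¬ G.Adj p q1 := by
  intro hpq
  have ha := hp.1
  have hb := hp'.1
  have hy1 := hq1.1
  have hy2 := hq2.1
  have hqq : ¬ G.Adj q1 q2 := fun k => far h2 k hab (nonAdj_of hq1 ha h1a.symm)
    (nonAdj_of hq1 hb h1b.symm) (nonAdj_of hq2 ha h2a.symm) (nonAdj_of hq2 hb h2b.symm)
  have hby2 : ¬ G.Adj b y2 := fun k => far h2 hpq k (nonAdj_of hp hb hab.ne')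
    (nonAdj_of hp hy2 h2a) (nonAdj_of hq1 hb h1b.symm) (nonAdj_of hq1 hy2 h12.symm)
  have hpq2 : G.Adj p q2 := by
    by_contra k
    exact far h2 hpq hq2.2.2.1 (nonAdj_of hp hy2 h2a) (fun h => k h.symm)
      (nonAdj_of hq1 hy2 h12.symm) (fun h => hqq h.symm)
  have hby1 : ¬ G.Adj b y1 := fun k => far h2 hpq2 k (nonAdj_of hp hb hab.ne')
    (nonAdj_of hp hy1 h1a) (nonAdj_of hq2 hb h2b.symm) (nonAdj_of hq2 hy1 h12)
  have hpq1' : G.Adj p' q1 := by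
    by_contra k
    exact far h2 hp'.2.2.1 hq1.2.2.1 (fun h => hby1 h.symm)
      (fun h => nonAdj_of hq1 hb h1b.symm h.symm) (nonAdj_of hp' hy1 h1b) (fun h => k h.symm)
  have hay2 : ¬ G.Adj a y2 := fun k => far h2 hpq1' k (nonAdj_of hp' ha hab.ne)
    (nonAdj_of hp' hy2 h2b) (nonAdj_of hq1 ha h1a.symm) (nonAdj_of hq1 hy2 h12.symm)
  exact far h2 hq2.2.2.1 hab hay2 hby2 (nonAdj_of hq2 ha h2a.symm) (nonAdj_of hq2 hb h2b.symm)

/-- In a `2K₂`-free graph with an edge `ab` and a minimal dominating set `X` containing `a`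
and `b` with `|X| > α(G)`, with `N, A, Y, Z` as in the paper, if `|Y| > 1` then every
private neighbour of `a` or of `b` (w.r.t. `X`) has no neighbour in `Z`. -/
theorem twoK2Free_claim5 {V : Type*} [Fintype V] (G : SimpleGraph V) (h2 : TwoK2Free G)
    (a b : V) (hab : G.Adj a b)
    (X : Set V) (hX : MinimalDominating G X) (ha : a ∈ X) (hb : b ∈ X)
    (hbig : indepNum G < X.ncard)
    (N A Y Z : Set V)
    (hN : N = {v : V | v ≠ a ∧ v ≠ b ∧ (G.Adj a v ∨ G.Adj b v)})
    (hA : A = {v : V | ¬ G.Adj a v ∧ ¬ G.Adj b v})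
    (hY : Y = X ∩ N)
    (hZ : Z = {v ∈ A | ∃ y ∈ Y, G.Adj y v})
    (hY1 : 1 < Y.ncard) :
    ∀ p : V, (PrivateNbr G X a p ∨ PrivateNbr G X b p) → ∀ z ∈ Z, ¬ G.Adj p z := by
  exfalso
  have hnon : ∀ x ∈ X, (∃ u ∈ X, G.Adj u x) → ∃ q, PrivateNbr G X x q := by
    rintro x hx ⟨u, hu, hux⟩
    obtain ⟨v, ⟨-, h⟩ | h⟩ := exists_priv G X hX x hx
    · exact absurd hux (h u hu)
    · exact ⟨v, h⟩
  obtain ⟨p, hp⟩ := hnon a ha ⟨b, hb, hab.symm⟩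
  obtain ⟨p', hp'⟩ := hnon b hb ⟨a, ha, hab⟩
  obtain ⟨y1, hy1, y2, hy2, h12⟩ := (Set.one_lt_ncard (Set.toFinite _)).1 hY1
  subst hY hN
  obtain ⟨hy1X, h1a, h1b, hy1⟩ := hy1
  obtain ⟨hy2X, h2a, h2b, hy2⟩ := hy2
  have hYq : ∀ y ∈ X, (G.Adj a y ∨ G.Adj b y) → ∃ q, PrivateNbr G X y q := by
    rintro y hy (h | h)
    · exact hnon y hy ⟨a, ha, h⟩
    · exact hnon y hy ⟨b, hb, h⟩
  obtain ⟨q1, hq1⟩ := hYq y1 hy1X hy1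
  obtain ⟨q2, hq2⟩ := hYq y2 hy2X hy2
  -- private neighbours of `a` and `b` miss those of any other vertex
  have hA' : ∀ r y q, PrivateNbr G X a r → PrivateNbr G X y q → y ≠ a → y ≠ b →
      ¬ G.Adj r q := by
    intro r y q hr hq hya hyb
    by_cases h : y = y1
    · subst h
      exact priv_core h2 hab hr hp' hq hq2 hya hyb h2a h2b h12
    · exact priv_core h2 hab hr hp' hq hq1 hya hyb h1a h1b h
  have hB' : ∀ r y q, PrivateNbr G X b r → PrivateNbr G X y q → y ≠ a → y ≠ b →
      ¬ G.Adj r q := by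
    intro r y q hr hq hya hyb
    by_cases h : y = y1
    · subst h
      exact priv_core h2 hab.symm hr hp hq hq2 hyb hya h2b h2a h12
    · exact priv_core h2 hab.symm hr hp hq hq1 hyb hya h1b h1a h
  have hAB : ∀ r s, PrivateNbr G X a r → PrivateNbr G X b s → ¬ G.Adj r s := by
    intro r s hr hs k
    exact far h2 k hq1.2.2.1 (nonAdj_of hr hy1X h1a)
      (fun h => hA' r y1 q1 hr hq1 h1a h1b h.symm)
      (nonAdj_of hs hy1X h1b) (fun h => hB' s y1 q1 hs hq1 h1a h1b h.symm)
  have hPP : ∀ x y r s, PrivateNbr G X x r → PrivateNbr G X y s → x ≠ y → ¬ G.Adj r s := by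
    intro x y r s hr hs hxy k
    by_cases xa : x = a
    · subst xa
      by_cases yb : y = b
      · subst yb; exact hAB r s hr hs k
      · exact hA' r y s hr hs hxy.symm yb k
    by_cases xb : x = b
    · subst xb
      by_cases ya : y = a
      · subst ya; exact hAB s r hs hr k.symm
      · exact hB' r y s hr hs ya hxy.symm k
    by_cases ya : y = a
    · subst ya; exact hA' s x r hs hr xa xb k.symm
    by_cases yb : y = b
    · subst yb; exact hB' s x r hs hr xa xb k.symm
    exact far h2 k hab (nonAdj_of hr ha (Ne.symm xa)) (nonAdj_of hr hb (Ne.symm xb))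
      (nonAdj_of hs ha (Ne.symm ya)) (nonAdj_of hs hb (Ne.symm yb))
  have hex : ∀ x, ∃ v, x ∈ X → (v = x ∧ ∀ u ∈ X, ¬ G.Adj u x) ∨ PrivateNbr G X x v := by
    intro x
    by_cases hx : x ∈ X
    · obtain ⟨v, hv⟩ := exists_priv G X hX x hx
      exact ⟨v, fun _ => hv⟩
    · exact ⟨x, fun h => absurd h hx⟩
  choose f hf using hex
  have hinj : Set.InjOn f X := by
    intro x hx y hy hxy
    rcases hf x hx with ⟨e1, h1⟩ | h1 <;> rcases hf y hy with ⟨e2, h3⟩ | h3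
    · rw [← e1, ← e2, hxy]
    · rw [← hxy, e1] at h3; exact absurd hx h3.2.1
    · rw [hxy, e2] at h1; exact absurd hy h1.2.1
    · rw [hxy] at h1
      exact h3.2.2.2 x hx h1.2.2.1
  have hind : IndepSet G (f '' X) := by
    rintro _ ⟨x, hx, rfl⟩ _ ⟨y, hy, rfl⟩ k
    by_cases hxy : x = y
    · subst hxy; exact G.loopless.irrefl _ k
    rcases hf x hx with ⟨e1, h1⟩ | h1 <;> rcases hf y hy with ⟨e2, h3⟩ | h3
    · rw [e1, e2] at k; exact h3 x hx k
    · rw [e1] at k; exact nonAdj_of h3 hx hxy k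
    · rw [e2] at k; exact nonAdj_of h1 hy (Ne.symm hxy) k.symm
    · exact hPP x y _ _ h1 h3 hxy k
  have hle : X.ncard ≤ indepNum G := by
    rw [← Set.ncard_image_of_injOn hinj]
    refine le_csSup ⟨Nat.card V, ?_⟩ ⟨_, hind, rfl⟩
    rintro n ⟨S, -, rfl⟩
    rw [← Set.ncard_univ]
    exact Set.ncard_le_ncard (Set.subset_univ S) (Set.toFinite _)
  omega
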